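/- arXiv:2410.15256 — 2 statements merged into one kernel-verified Lean document; each statement's English description precedes it below -/
import Mathlib

section
/- For each integer k ≥ 0 and z ∈ ℝ, define the Bessel function J_k(z) = (1/π)·∫_0^π cos(kτ − z·sin τ) dτ. Then for every t ∈ ℝ and every x ∈ [−1,1], the Jacobi–Anger expansion holds: exp(−i·x·t) = J_0(−t) + 2·Σ_{k=1}^∞ i^k · J_k(−t) · T_k(x), where T_k is the k-th Chebyshev polynomial of the first kind and the series converges absolutely. -/
open Complex

/-- The Bessel function of the first kind of integer order `k`, via the integral
representation `J_k(z) = (1/π)·∫_0^π cos(kτ − z·sin τ) dτ`. -/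
noncomputable def besselJ (k : ℕ) (z : ℝ) : ℝ :=
  (1 / Real.pi) * ∫ τ in (0 : ℝ)..Real.pi, Real.cos (k * τ - z * Real.sin τ)

/-- Bessel function of integer order. -/
noncomputable def besselZ (n : ℤ) (z : ℝ) : ℝ :=
  (1 / Real.pi) * ∫ τ in (0 : ℝ)..Real.pi, Real.cos (n * τ - z * Real.sin τ)

lemma besselZ_nat (k : ℕ) (z : ℝ) : besselZ k z = besselJ k z := by
  simp [besselZ, besselJ]

lemma besselZ_neg (k : ℕ) (z : ℝ) : besselZ (-k) z = (-1) ^ k * besselJ k z := by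
  unfold besselZ besselJ
  have h := intervalIntegral.integral_comp_sub_left (a := 0) (b := Real.pi)
    (fun τ => Real.cos (((-k : ℤ) : ℝ) * τ - z * Real.sin τ)) Real.pi
  simp only [sub_self, sub_zero] at h
  rw [← h, mul_left_comm ((-1 : ℝ) ^ k),
    ← intervalIntegral.integral_const_mul ((-1 : ℝ) ^ k)]
  congr 1
  refine intervalIntegral.integral_congr (E := ℝ) fun τ _ => ?_
  rw [Real.sin_pi_sub, ← Real.cos_sub_nat_mul_pi]
  congr 1
  push_cast
  ring

lemma besselZ_abs_le (n : ℤ) (z : ℝ) : |besselZ n z| ≤ 1 := by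
  unfold besselZ
  have h := intervalIntegral.norm_integral_le_of_norm_le_const (a := 0) (b := Real.pi) (C := 1)
    (f := fun τ => Real.cos (n * τ - z * Real.sin τ)) (fun x _ => Real.abs_cos_le_one _)
  rw [Real.norm_eq_abs, sub_zero, abs_of_pos Real.pi_pos, one_mul] at h
  rw [abs_mul, abs_of_pos (by positivity), one_div, inv_mul_le_iff₀ Real.pi_pos, mul_one]
  exact h

lemma besselZ_rec (n : ℤ) (z : ℝ) :
    n * besselZ n z = z / 2 * (besselZ (n - 1) z + besselZ (n + 1) z) := by
  have h := intervalIntegral.integral_eq_sub_of_hasDerivAt (a := 0) (b := Real.pi)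
    (f := fun τ => Real.sin (n * τ - z * Real.sin τ))
    (f' := fun τ => Real.cos (n * τ - z * Real.sin τ) * (n * 1 - z * Real.cos τ))
    (fun x _ => ((((hasDerivAt_id x).const_mul (n : ℝ)).sub
      ((Real.hasDerivAt_sin x).const_mul z)).sin))
    (Continuous.intervalIntegrable (by fun_prop) _ _)
  have e : ∀ τ : ℝ, Real.cos (n * τ - z * Real.sin τ) * (n * 1 - z * Real.cos τ)
      = n * Real.cos (n * τ - z * Real.sin τ) -
        (z / 2 * Real.cos ((n - 1 : ℤ) * τ - z * Real.sin τ)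
          + z / 2 * Real.cos ((n + 1 : ℤ) * τ - z * Real.sin τ)) := by
    intro τ
    have e1 : ((n - 1 : ℤ) : ℝ) * τ - z * Real.sin τ = (n * τ - z * Real.sin τ) - τ := by
      push_cast; ring
    have e2 : ((n + 1 : ℤ) : ℝ) * τ - z * Real.sin τ = (n * τ - z * Real.sin τ) + τ := by
      push_cast; ring
    rw [e1, e2, Real.cos_sub (_ - _), Real.cos_add]
    ring
  simp only [e] at h
  rw [intervalIntegral.integral_sub (Continuous.intervalIntegrable (by fun_prop) _ _)
      (Continuous.intervalIntegrable (by fun_prop) _ _),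
    intervalIntegral.integral_add (Continuous.intervalIntegrable (by fun_prop) _ _)
      (Continuous.intervalIntegrable (by fun_prop) _ _),
    intervalIntegral.integral_const_mul, intervalIntegral.integral_const_mul,
    intervalIntegral.integral_const_mul] at h
  simp only [Real.sin_pi, Real.sin_zero, mul_zero, sub_zero, Real.sin_int_mul_pi] at h
  unfold besselZ
  linear_combination (1 / Real.pi) * h

lemma besselZ_bound1 (n : ℤ) (z : ℝ) : |(n : ℝ)| * |besselZ n z| ≤ |z| := by
  rw [← abs_mul, besselZ_rec, abs_mul, abs_div, abs_two]
  have h1 := besselZ_abs_le (n - 1) z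
  have h2 := besselZ_abs_le (n + 1) z
  have h3 := abs_add_le (besselZ (n - 1) z) (besselZ (n + 1) z)
  have h4 := abs_nonneg z
  nlinarith

lemma besselZ_bound2 (n : ℤ) (z : ℝ) : (n : ℝ) ^ 2 * |besselZ n z| ≤ |z| * (|z| + 1) := by
  have h : (n : ℝ) ^ 2 * |besselZ n z| = |(n : ℝ)| * |n * besselZ n z| := by
    rw [abs_mul, ← mul_assoc, ← sq, sq_abs]
  rw [h, besselZ_rec, abs_mul, abs_div, abs_two]
  have h1 := besselZ_abs_le (n - 1) z
  have h2 := besselZ_abs_le (n + 1) z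
  have b1 := besselZ_bound1 (n - 1) z
  have b2 := besselZ_bound1 (n + 1) z
  push_cast at b1 b2
  have h3 := abs_add_le (besselZ (n - 1) z) (besselZ (n + 1) z)
  have t1 : |(n : ℝ)| ≤ |(n : ℝ) - 1| + 1 := by
    have := abs_add_le ((n : ℝ) - 1) 1
    simpa using this
  have t2 : |(n : ℝ)| ≤ |(n : ℝ) + 1| + 1 := by
    have := abs_sub ((n : ℝ) + 1) 1
    simpa using this
  have c1 : |(n : ℝ)| * |besselZ (n - 1) z| ≤ |z| + 1 := by
    have := mul_le_mul_of_nonneg_right t1 (abs_nonneg (besselZ (n - 1) z))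
    linarith
  have c2 : |(n : ℝ)| * |besselZ (n + 1) z| ≤ |z| + 1 := by
    have := mul_le_mul_of_nonneg_right t2 (abs_nonneg (besselZ (n + 1) z))
    linarith
  have c3 : |(n : ℝ)| * |besselZ (n - 1) z + besselZ (n + 1) z| ≤ 2 * (|z| + 1) := by
    have := mul_le_mul_of_nonneg_left h3 (abs_nonneg (n : ℝ))
    linarith
  have := mul_le_mul_of_nonneg_left c3 (abs_nonneg z)
  linarith

lemma besselZ_summable (z : ℝ) : Summable (fun n : ℤ => ‖(besselZ n z : ℂ)‖) := by
  have hs := ((Real.summable_one_div_int_pow (p := 2)).2 (by norm_num)).mul_left (|z| * (|z| + 1))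
  refine Summable.of_norm_bounded_eventually hs ?_
  filter_upwards [(Set.finite_singleton (0 : ℤ)).compl_mem_cofinite] with n hn
  have hn' : (n : ℝ) ≠ 0 := by simpa using hn
  rw [norm_norm, Complex.norm_real, Real.norm_eq_abs, mul_one_div, le_div_iff₀ (by positivity),
    mul_comm]
  exact besselZ_bound2 n z

instance factTwoPi : Fact (0 < 2 * Real.pi) := ⟨Real.two_pi_pos⟩

/-- The generating function on the circle. -/
noncomputable def genFun (z : ℝ) : C(AddCircle (2 * Real.pi), ℂ) :=
  ⟨fun x => Complex.exp (z / 2 * (fourier 1 x - fourier (-1) x)), by fun_prop⟩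

lemma fourier_two_pi (n : ℤ) (x : ℝ) :
    fourier n (x : AddCircle (2 * Real.pi)) = Complex.exp (n * x * I) := by
  rw [fourier_coe_apply]
  congr 1
  have : (Real.pi : ℂ) ≠ 0 := by exact_mod_cast Real.pi_ne_zero
  push_cast
  field_simp

lemma genFun_apply (z x : ℝ) :
    genFun z (x : AddCircle (2 * Real.pi)) = Complex.exp (z * Real.sin x * I) := by
  simp only [genFun, ContinuousMap.coe_mk, fourier_two_pi]
  congr 1
  rw [Complex.ofReal_sin, Complex.sin]
  push_cast
  have := Complex.I_sq
  simp only [one_mul, neg_mul]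
  linear_combination ((z : ℂ) / 2 * (Complex.exp (x * I) - Complex.exp (-(x * I)))) * this

lemma genFun_coeff (z : ℝ) (n : ℤ) : fourierCoeff (genFun z) n = (besselZ n z : ℂ) := by
  rw [fourierCoeff_eq_intervalIntegral _ n (-Real.pi)]
  have e : ∀ x : ℝ, fourier (-n) (x : AddCircle (2 * Real.pi)) • genFun z x =
      Complex.exp (-((n * x - z * Real.sin x : ℝ) : ℂ) * I) := by
    intro x
    rw [fourier_two_pi, genFun_apply, smul_eq_mul, ← Complex.exp_add]
    congr 1
    push_cast
    ring
  simp only [e]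
  have hc : Continuous fun x : ℝ => Complex.exp (-((n * x - z * Real.sin x : ℝ) : ℂ) * I) := by
    fun_prop
  rw [show -Real.pi + 2 * Real.pi = Real.pi by ring,
    ← intervalIntegral.integral_add_adjacent_intervals (b := 0)
      (hc.intervalIntegrable _ _) (hc.intervalIntegrable _ _)]
  have h := intervalIntegral.integral_comp_neg (a := 0) (b := Real.pi)
    (fun x : ℝ => Complex.exp (-((n * x - z * Real.sin x : ℝ) : ℂ) * I))
  rw [neg_zero] at h
  rw [← h, ← intervalIntegral.integral_add (Continuous.intervalIntegrable (by fun_prop) _ _)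
      (hc.intervalIntegrable _ _)]
  have e2 : ∀ x : ℝ, Complex.exp (-((n * (-x) - z * Real.sin (-x) : ℝ) : ℂ) * I) +
      Complex.exp (-((n * x - z * Real.sin x : ℝ) : ℂ) * I) =
      ((2 * Real.cos (n * x - z * Real.sin x) : ℝ) : ℂ) := by
    intro x
    rw [Complex.ofReal_mul, Complex.ofReal_cos, Complex.ofReal_ofNat, Complex.two_cos]
    congr 2
    rw [Real.sin_neg]
    push_cast
    ring
  simp only [e2]
  rw [intervalIntegral.integral_ofReal, intervalIntegral.integral_const_mul, besselZ,
    Complex.real_smul, ← Complex.ofReal_mul]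
  congr 1
  have := Real.pi_ne_zero
  field_simp

lemma genFun_hasSum (z x : ℝ) :
    HasSum (fun n : ℤ => (besselZ n z : ℂ) * Complex.exp (n * x * I))
      (Complex.exp (z * Real.sin x * I)) := by
  have hs : Summable (fourierCoeff (genFun z)) := by
    have : fourierCoeff (genFun z) = fun n => (besselZ n z : ℂ) := funext (genFun_coeff z)
    rw [this]
    exact (besselZ_summable z).of_norm
  have h := has_pointwise_sum_fourier_series_of_summable hs (x : AddCircle (2 * Real.pi))
  simpa only [genFun_coeff, genFun_apply, fourier_two_pi, smul_eq_mul] using h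

lemma pair_eq (k : ℕ) (z θ : ℝ) :
    (besselZ k z : ℂ) * Complex.exp ((k : ℤ) * (θ + Real.pi / 2 : ℝ) * I) +
      (besselZ (-k) z : ℂ) * Complex.exp ((-k : ℤ) * (θ + Real.pi / 2 : ℝ) * I) =
    2 * I ^ k * (besselJ k z : ℂ) * (Real.cos (k * θ) : ℂ) := by
  have e1 : Complex.exp ((k : ℤ) * (θ + Real.pi / 2 : ℝ) * I) =
      I ^ k * Complex.exp (k * θ * I) := by
    have hI : I ^ k = Complex.exp (k * (Real.pi / 2 * I)) := by
      rw [Complex.exp_nat_mul, Complex.exp_pi_div_two_mul_I]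
    rw [hI, ← Complex.exp_add]
    congr 1
    push_cast
    ring
  have e2 : Complex.exp ((-k : ℤ) * (θ + Real.pi / 2 : ℝ) * I) =
      (-I) ^ k * Complex.exp (-(k * θ) * I) := by
    conv_rhs => rw [← Complex.exp_neg_pi_div_two_mul_I, ← Complex.exp_nat_mul, ← Complex.exp_add]
    congr 1
    push_cast
    ring
  rw [e1, e2, besselZ_nat, besselZ_neg, Complex.ofReal_cos, Complex.cos]
  have e3 : (-I) ^ k * (-1 : ℂ) ^ k = I ^ k := by rw [← mul_pow]; simp
  push_cast
  linear_combination (besselJ k z * Complex.exp (-(k * θ) * I)) * e3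

/-- The Jacobi–Anger expansion: for every `t ∈ ℝ` and `x ∈ [−1,1]`,
`exp(−i·x·t) = J_0(−t) + 2·Σ_{k=1}^∞ i^k·J_k(−t)·T_k(x)`, with absolute convergence
(`T_k` is the `k`-th Chebyshev polynomial of the first kind). -/
theorem jacobi_anger_expansion (t x : ℝ) (hx : x ∈ Set.Icc (-1 : ℝ) 1) :
    HasSum
        (fun k : ℕ =>
          2 * I ^ (k + 1) * (besselJ (k + 1) (-t) : ℂ) *
            (((Polynomial.Chebyshev.T ℝ ((k : ℤ) + 1)).eval x : ℝ) : ℂ))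
        (Complex.exp (-(I * x * t)) - (besselJ 0 (-t) : ℂ)) ∧
      Summable
        (fun k : ℕ =>
          ‖2 * I ^ (k + 1) * (besselJ (k + 1) (-t) : ℂ) *
            (((Polynomial.Chebyshev.T ℝ ((k : ℤ) + 1)).eval x : ℝ) : ℂ)‖) := by
  obtain ⟨θ, rfl⟩ : ∃ θ, Real.cos θ = x := ⟨Real.arccos x, Real.cos_arccos hx.1 hx.2⟩
  have hT : ∀ k : ℕ, (Polynomial.Chebyshev.T ℝ ((k : ℤ) + 1)).eval (Real.cos θ) =
      Real.cos ((k + 1 : ℕ) * θ) := by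
    intro k
    rw [Polynomial.Chebyshev.T_real_cos]
    push_cast
    rfl
  simp only [hT]
  constructor
  · have h := (genFun_hasSum (-t) (θ + Real.pi / 2)).nat_add_neg
    simp only [Int.cast_natCast] at h
    have h' : HasSum (fun k : ℕ => 2 * I ^ k * (besselJ k (-t) : ℂ) * (Real.cos (k * θ) : ℂ))
        (Complex.exp (-(I * Real.cos θ * t)) + (besselJ 0 (-t) : ℂ)) := by
      convert h using 1
      · funext k
        rw [← pair_eq]
        simp
      · rw [Real.sin_add_pi_div_two]
        have := besselZ_nat 0 (-t)
        simp only [Nat.cast_zero] at this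
        simp only [this, Int.cast_zero, zero_mul, Complex.exp_zero, mul_one]
        congr 2
        push_cast
        ring
    rw [← hasSum_nat_add_iff' 1] at h'
    have e0 : Complex.exp (-(I * Real.cos θ * t)) - (besselJ 0 (-t) : ℂ) =
        Complex.exp (-(I * Real.cos θ * t)) + (besselJ 0 (-t) : ℂ) -
          ∑ i ∈ Finset.range 1, 2 * I ^ i * (besselJ i (-t) : ℂ) * (Real.cos (i * θ) : ℂ) := by
      rw [Finset.sum_range_one, Nat.cast_zero, zero_mul, Real.cos_zero, pow_zero,
        Complex.ofReal_one]
      ring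
    rw [e0]
    exact h'
  · have hs := ((besselZ_summable (-t)).comp_injective
      (i := fun k : ℕ => ((k + 1 : ℕ) : ℤ)) (fun a b h => by simpa using h)).mul_left 2
    refine Summable.of_nonneg_of_le (fun _ => norm_nonneg _) (fun k => ?_) hs
    rw [Function.comp_apply, besselZ_nat]
    rw [norm_mul, norm_mul, norm_mul, norm_pow, Complex.norm_I, one_pow, mul_one,
      Complex.norm_ofNat, Complex.norm_real (Real.cos _)]
    exact mul_le_of_le_one_right (by positivity) (Real.abs_cos_le_one _)
end

section
/- For each integer k ≥ 0 and z ∈ ℝ, define J_k(z) = (1/π)·∫_0^π cos(kτ − z·sin τ) dτ, and let T_k denote the k-th Chebyshev polynomial of the first kind. Then for every t ∈ ℝ, every x ∈ [−1,1], and every positive integer K, the truncation error of the Jacobi–Anger expansion satisfies |exp(−i·x·t) − (J_0(−t) + 2·Σ_{k=1}^{K} i^k · J_k(−t) · T_k(x))| ≤ 2·Σ_{k=K+1}^∞ (|t|/2)^k / k!. -/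
open Complex

open Filter Topology

lemma besselJ_hasDerivAt_aux (k : ℕ) (z : ℝ) :
    HasDerivAt (besselJ k)
      ((1 / Real.pi) * ∫ τ in (0 : ℝ)..Real.pi,
        Real.sin τ * Real.sin (k * τ - z * Real.sin τ)) z := by
  have h := (intervalIntegral.hasDerivAt_integral_of_dominated_loc_of_deriv_le
    (μ := MeasureTheory.volume) (a := 0) (b := Real.pi)
    (F := fun z τ => Real.cos (k * τ - z * Real.sin τ))
    (F' := fun z τ => Real.sin τ * Real.sin (k * τ - z * Real.sin τ))
    (x₀ := z) (s := Set.univ) (bound := fun _ => 1) univ_mem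
    (Eventually.of_forall fun y => (Continuous.aestronglyMeasurable (by fun_prop)))
    (Continuous.intervalIntegrable (by fun_prop) _ _)
    (Continuous.aestronglyMeasurable (by fun_prop))
    (Eventually.of_forall fun τ _ y _ => by
      rw [norm_mul]
      exact mul_le_one₀ (Real.abs_sin_le_one _) (norm_nonneg _) (Real.abs_sin_le_one _))
    (Continuous.intervalIntegrable (by fun_prop) _ _)
    (Eventually.of_forall fun τ _ y _ => by
      have h1 : HasDerivAt (fun y : ℝ => (k : ℝ) * τ - y * Real.sin τ) (-(1 * Real.sin τ)) y :=
        ((hasDerivAt_id y).mul_const (Real.sin τ)).const_sub _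
      exact h1.cos.congr_deriv (by ring))).2
  exact h.const_mul _

lemma besselJ_ibp (k : ℕ) (z : ℝ) :
    ∫ τ in (0 : ℝ)..Real.pi, (k - z * Real.cos τ) * Real.cos (k * τ - z * Real.sin τ) = 0 := by
  rw [intervalIntegral.integral_eq_sub_of_hasDerivAt
    (f := fun τ => Real.sin (k * τ - z * Real.sin τ))]
  · simp
  · intro τ _
    have h1 : HasDerivAt (fun τ : ℝ => (k : ℝ) * τ - z * Real.sin τ)
        (k * 1 - z * Real.cos τ) τ :=
      ((hasDerivAt_id τ).const_mul _).sub ((Real.hasDerivAt_sin τ).const_mul _)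
    exact h1.sin.congr_deriv (by ring)
  · exact Continuous.intervalIntegrable (by fun_prop) _ _

lemma besselJ_hasDerivAt (k : ℕ) (z : ℝ) :
    HasDerivAt (besselJ (k + 1)) ((besselJ k z - besselJ (k + 2) z) / 2) z := by
  convert besselJ_hasDerivAt_aux (k + 1) z using 1
  unfold besselJ
  rw [← mul_sub, ← intervalIntegral.integral_sub
    (Continuous.intervalIntegrable (by fun_prop) _ _)
    (Continuous.intervalIntegrable (by fun_prop) _ _), mul_div_assoc,
    ← intervalIntegral.integral_div]
  congr 2
  ext τ
  have h1 : ((k : ℕ) : ℝ) * τ - z * Real.sin τ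
      = (((k + 1 : ℕ) : ℝ) * τ - z * Real.sin τ) - τ := by push_cast; ring
  have h2 : ((k + 2 : ℕ) : ℝ) * τ - z * Real.sin τ
      = (((k + 1 : ℕ) : ℝ) * τ - z * Real.sin τ) + τ := by push_cast; ring
  rw [h1, h2, Real.cos_sub, Real.cos_add]
  ring

lemma besselJ_zero_hasDerivAt (z : ℝ) : HasDerivAt (besselJ 0) (-besselJ 1 z) z := by
  convert besselJ_hasDerivAt_aux 0 z using 1
  have h0 : ∫ τ in (0 : ℝ)..Real.pi, Real.cos τ * Real.cos (z * Real.sin τ) = 0 := by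
    have h := intervalIntegral.integral_comp_sub_left (a := 0) (b := Real.pi)
      (fun τ => Real.cos τ * Real.cos (z * Real.sin τ)) Real.pi
    simp only [Real.cos_pi_sub, Real.sin_pi_sub, sub_self, sub_zero, neg_mul,
      intervalIntegral.integral_neg] at h
    linarith
  unfold besselJ
  have h3 : ∫ τ in (0 : ℝ)..Real.pi, Real.cos ((1 : ℕ) * τ - z * Real.sin τ)
      = (∫ τ in (0 : ℝ)..Real.pi, Real.cos τ * Real.cos (z * Real.sin τ)) +
        ∫ τ in (0 : ℝ)..Real.pi, Real.sin τ * Real.sin (z * Real.sin τ) := by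
    rw [← intervalIntegral.integral_add
      (Continuous.intervalIntegrable (by fun_prop) _ _)
      (Continuous.intervalIntegrable (by fun_prop) _ _)]
    congr 1
    ext τ
    rw [Real.cos_sub]
    simp
  rw [h3, h0]
  simp

lemma besselJ_rec (k : ℕ) (z : ℝ) :
    z * ((besselJ k z - besselJ (k + 2) z) / 2) + (k + 1) * besselJ (k + 1) z
      = z * besselJ k z := by
  rw [(besselJ_hasDerivAt k z).unique (besselJ_hasDerivAt_aux (k + 1) z)]
  have h := besselJ_ibp (k + 1) z
  unfold besselJ
  have e : ∀ A B C : ℝ, z * A + (k + 1) * B - z * C = 0 →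
      z * (1 / Real.pi * A) + (k + 1) * (1 / Real.pi * B) = z * (1 / Real.pi * C) := by
    intro A B C h
    linear_combination (1 / Real.pi) * h
  apply e
  rw [← h, ← intervalIntegral.integral_const_mul, ← intervalIntegral.integral_const_mul,
    ← intervalIntegral.integral_const_mul,
    ← intervalIntegral.integral_add
      (Continuous.intervalIntegrable (by fun_prop) _ _)
      (Continuous.intervalIntegrable (by fun_prop) _ _),
    ← intervalIntegral.integral_sub
      (Continuous.intervalIntegrable (by fun_prop) _ _)
      (Continuous.intervalIntegrable (by fun_prop) _ _)]
  congr 1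
  ext τ
  have h1 : ((k : ℕ) : ℝ) * τ - z * Real.sin τ
      = (((k + 1 : ℕ) : ℝ) * τ - z * Real.sin τ) - τ := by push_cast; ring
  rw [h1, Real.cos_sub (((k + 1 : ℕ) : ℝ) * τ - z * Real.sin τ) τ]
  push_cast
  ring

lemma besselJ_bound (k : ℕ) : ∀ z : ℝ, |besselJ k z| ≤ (|z| / 2) ^ k / (Nat.factorial k) := by
  induction k with
  | zero =>
    intro z
    unfold besselJ
    have h := intervalIntegral.norm_integral_le_of_norm_le_const (a := 0) (b := Real.pi)
      (f := fun τ => Real.cos ((0 : ℕ) * τ - z * Real.sin τ)) (C := 1)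
      (fun τ _ => Real.abs_cos_le_one _)
    rw [Real.norm_eq_abs, sub_zero, abs_of_pos Real.pi_pos] at h
    rw [abs_mul, abs_of_pos (by positivity : 0 < 1 / Real.pi)]
    have hp := Real.pi_pos
    calc _ ≤ 1 / Real.pi * (1 * Real.pi) := by gcongr
      _ = _ := by field_simp; simp
  | succ k ih =>
    intro z
    have hd : ∀ u : ℝ, HasDerivAt (fun u : ℝ => u ^ (k + 1) * besselJ (k + 1) (z * u))
        (u ^ k * (z * u * besselJ k (z * u))) u := by
      intro u
      have h1 : HasDerivAt (fun u : ℝ => z * u) (z * 1) u := (hasDerivAt_id u).const_mul z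
      have h2 : HasDerivAt (fun u : ℝ => besselJ (k + 1) (z * u)) _ u :=
        (besselJ_hasDerivAt k (z * u)).comp u h1
      have h3 := (hasDerivAt_pow (k + 1) u).mul h2
      refine h3.congr_deriv ?_
      rw [← besselJ_rec]
      simp only [Nat.add_sub_cancel]
      push_cast
      ring
    have hB : ∀ u : ℝ, HasDerivAt
        (fun u : ℝ => (|z| / 2) ^ (k + 1) / (Nat.factorial (k + 1)) * u ^ (2 * k + 2))
        ((|z| / 2) ^ (k + 1) / (Nat.factorial (k + 1)) * (((2 * k + 2 : ℕ) : ℝ) * u ^ (2 * k + 1)))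
        u := fun u => (hasDerivAt_pow (2 * k + 2) u).const_mul _
    have h := image_norm_le_of_norm_deriv_right_le_deriv_boundary (a := 0) (b := 1)
      (f := fun u : ℝ => u ^ (k + 1) * besselJ (k + 1) (z * u))
      (fun u _ => (hd u).continuousAt.continuousWithinAt)
      (fun u _ => (hd u).hasDerivWithinAt) (by simp) hB
      (fun u hu => by
        have hu0 : 0 ≤ u := hu.1
        have := ih (z * u)
        rw [Real.norm_eq_abs, abs_mul, abs_mul, abs_mul, abs_pow, abs_of_nonneg hu0]
        calc _ ≤ u ^ k * (|z| * u * ((|z * u| / 2) ^ k / (Nat.factorial k))) := by gcongr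
          _ = _ := by
            rw [abs_mul, abs_of_nonneg hu0, Nat.factorial_succ]
            push_cast
            have : (k : ℝ) + 1 ≠ 0 := by positivity
            have : (Nat.factorial k : ℝ) ≠ 0 := by positivity
            field_simp
            ring)
      (Set.right_mem_Icc.2 zero_le_one)
    simpa using h

/-- The truncated Jacobi–Anger sum. -/
noncomputable def jaSum (x : ℝ) (N : ℕ) (z : ℝ) : ℂ :=
  (besselJ 0 z : ℂ) + 2 * ∑ k ∈ Finset.Icc 1 N, I ^ k * (besselJ k z : ℂ) *
    (((Polynomial.Chebyshev.T ℝ (k : ℤ)).eval x : ℝ) : ℂ)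

lemma jaSum_succ (x : ℝ) (N : ℕ) (z : ℝ) : jaSum x (N + 1) z = jaSum x N z +
    2 * (I ^ (N + 1) * (((Polynomial.Chebyshev.T ℝ ((N + 1 : ℕ) : ℤ)).eval x : ℝ) : ℂ)) *
      (besselJ (N + 1) z : ℂ) := by
  unfold jaSum
  rw [Finset.sum_Icc_succ_top (by omega)]
  ring

lemma cheb_rec (x : ℝ) (N : ℕ) :
    (Polynomial.Chebyshev.T ℝ ((N + 2 : ℕ) : ℤ)).eval x =
      2 * x * (Polynomial.Chebyshev.T ℝ ((N + 1 : ℕ) : ℤ)).eval x -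
        (Polynomial.Chebyshev.T ℝ (N : ℤ)).eval x := by
  push_cast
  rw [Polynomial.Chebyshev.T_add_two]
  simp

lemma jaSum_hasDerivAt (x : ℝ) (N : ℕ) (z : ℝ) :
    HasDerivAt (jaSum x N) (I * x * jaSum x N z
      - I ^ N * besselJ (N + 1) z * ((Polynomial.Chebyshev.T ℝ (N : ℤ)).eval x : ℝ)
      - I ^ (N + 1) * besselJ N z *
        ((Polynomial.Chebyshev.T ℝ ((N + 1 : ℕ) : ℤ)).eval x : ℝ)) z := by
  induction N with
  | zero =>
    have h : jaSum x 0 = fun z => (besselJ 0 z : ℂ) := by ext z; simp [jaSum]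
    rw [h]
    refine (besselJ_zero_hasDerivAt z).ofReal_comp.congr_deriv ?_
    simp
    ring
  | succ N ih =>
    have h : jaSum x (N + 1) = fun z => jaSum x N z +
      2 * (I ^ (N + 1) * (((Polynomial.Chebyshev.T ℝ ((N + 1 : ℕ) : ℤ)).eval x : ℝ) : ℂ)) *
      (besselJ (N + 1) z : ℂ) := by
      ext z; exact jaSum_succ x N z
    rw [jaSum_succ, h]
    refine (ih.add ((besselJ_hasDerivAt N z).ofReal_comp.const_mul _)).congr_deriv ?_
    rw [show N + 1 + 1 = N + 2 from rfl, cheb_rec x N]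
    push_cast
    linear_combination (-(I ^ N * (besselJ (N + 1) z : ℂ) *
      Polynomial.eval (x : ℂ) (Polynomial.Chebyshev.T ℂ (N : ℤ)))) * I_sq

lemma cheb_le (x : ℝ) (hx : x ∈ Set.Icc (-1 : ℝ) 1) (N : ℕ) :
    ‖(((Polynomial.Chebyshev.T ℝ (N : ℤ)).eval x : ℝ) : ℂ)‖ ≤ 1 := by
  rw [Complex.norm_real]
  exact Polynomial.Chebyshev.abs_eval_T_real_le_one _ (abs_le.2 hx)

lemma jaSum_zero (x : ℝ) (N : ℕ) : jaSum x N 0 = 1 := by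
  induction N with
  | zero =>
    have hp := Real.pi_ne_zero
    simp [jaSum, besselJ, hp]
  | succ N ih =>
    have h := besselJ_bound (N + 1) 0
    simp at h
    rw [jaSum_succ, ih, h]
    simp

lemma jaSum_error (x : ℝ) (hx : x ∈ Set.Icc (-1 : ℝ) 1) (N : ℕ) (z : ℝ) :
    ‖cexp (I * x * z) - jaSum x N z‖ ≤
      ((|z| / 2) ^ (N + 1) / (Nat.factorial (N + 1)) + (|z| / 2) ^ N / (Nat.factorial N)) * |z| := by
  have hn : ∀ y : ℝ, ‖cexp (-(I * x * y))‖ = 1 := by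
    intro y
    rw [Complex.norm_exp]; simp
  have hE : ∀ y : ℝ, HasDerivAt (fun y : ℝ => cexp (-(I * x * y)))
      (cexp (-(I * x * y)) * (-(I * x * 1))) y := by
    intro y
    have h1 : HasDerivAt (fun y : ℝ => -(I * x * (y : ℂ))) (-(I * x * 1)) y :=
      ((Complex.ofRealCLM.hasDerivAt (x := y)).const_mul (I * (x : ℂ))).neg
    exact h1.cexp
  have h := Convex.norm_image_sub_le_of_norm_hasDerivWithin_le
    (f := fun y : ℝ => cexp (-(I * x * y)) * jaSum x N y)
    (s := Set.Icc (-|z|) |z|) (x := 0) (y := z)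
    (C := (|z| / 2) ^ (N + 1) / (Nat.factorial (N + 1)) + (|z| / 2) ^ N / (Nat.factorial N))
    (fun y _ => ((hE y).mul (jaSum_hasDerivAt x N y)).hasDerivWithinAt)
    (fun y hy => by
      have hy' : |y| ≤ |z| := abs_le.2 hy
      have e : cexp (-(I * x * y)) * (-(I * x * 1)) * jaSum x N y + cexp (-(I * x * y)) *
        (I * x * jaSum x N y
          - I ^ N * besselJ (N + 1) y * ((Polynomial.Chebyshev.T ℝ (N : ℤ)).eval x : ℝ)
          - I ^ (N + 1) * besselJ N y *
            ((Polynomial.Chebyshev.T ℝ ((N + 1 : ℕ) : ℤ)).eval x : ℝ)) =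
          - (cexp (-(I * x * y)) *
          (I ^ N * besselJ (N + 1) y * ((Polynomial.Chebyshev.T ℝ (N : ℤ)).eval x : ℝ)
          + I ^ (N + 1) * besselJ N y *
            ((Polynomial.Chebyshev.T ℝ ((N + 1 : ℕ) : ℤ)).eval x : ℝ))) := by ring
      rw [e, norm_neg, norm_mul, hn, one_mul]
      have key : ∀ a b : ℕ, ∀ c : ℕ, ‖I ^ a * (besselJ b y : ℂ) *
          ((Polynomial.Chebyshev.T ℝ (c : ℤ)).eval x : ℝ)‖ ≤
          (|z| / 2) ^ b / (Nat.factorial b) := by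
        intro a b c
        rw [norm_mul, norm_mul, norm_pow, Complex.norm_I, one_pow, one_mul, Complex.norm_real,
          Real.norm_eq_abs]
        calc _ ≤ |besselJ b y| * 1 := by
              gcongr
              exact cheb_le x hx c
          _ ≤ (|y| / 2) ^ b / (Nat.factorial b) := by rw [mul_one]; exact besselJ_bound b y
          _ ≤ _ := by gcongr
      exact (norm_add_le _ _).trans (add_le_add (key _ _ _) (key _ _ _)))
    (convex_Icc _ _) (by simp) (abs_le.1 le_rfl)
  have e2 : cexp (I * x * z) - jaSum x N z =
      - (cexp (I * x * z) * (cexp (-(I * x * z)) * jaSum x N z - 1)) := by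
    rw [mul_sub, ← mul_assoc, ← Complex.exp_add]
    simp
  have h1 : ‖cexp (I * x * z)‖ = 1 := by
    rw [Complex.norm_exp]; simp
  rw [e2, norm_neg, norm_mul, h1, one_mul]
  simpa [jaSum_zero] using h

lemma jaSum_diff (x : ℝ) (hx : x ∈ Set.Icc (-1 : ℝ) 1) (K m : ℕ) (z : ℝ) :
    ‖jaSum x (K + m) z - jaSum x K z‖ ≤
      2 * ∑ k ∈ Finset.range m, (|z| / 2) ^ (K + 1 + k) / (Nat.factorial (K + 1 + k)) := by
  induction m with
  | zero => simp
  | succ m ih =>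
    rw [← add_assoc, jaSum_succ, Finset.sum_range_succ, mul_add, add_sub_right_comm]
    refine (norm_add_le _ _).trans (add_le_add ih ?_)
    rw [norm_mul, norm_mul, norm_mul, norm_pow, Complex.norm_I, one_pow, one_mul,
      Complex.norm_real (besselJ _ _), Real.norm_eq_abs, show K + 1 + m = K + m + 1 by ring]
    have h1 := cheb_le x hx (K + m + 1)
    have h2 := besselJ_bound (K + m + 1) z
    calc _ ≤ ‖(2 : ℂ)‖ * 1 * ((|z| / 2) ^ (K + m + 1) / (Nat.factorial (K + m + 1))) := by gcongr
      _ = _ := by simp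

/-- Truncation error of the Jacobi–Anger expansion: for every `t ∈ ℝ`,
`x ∈ [−1,1]` and positive integer `K`,
`|exp(−i·x·t) − (J_0(−t) + 2·Σ_{k=1}^{K} i^k·J_k(−t)·T_k(x))| ≤ 2·Σ_{k=K+1}^∞ (|t|/2)^k/k!`
(`T_k` is the `k`-th Chebyshev polynomial of the first kind). -/
theorem jacobi_anger_truncation_error (t x : ℝ) (hx : x ∈ Set.Icc (-1 : ℝ) 1)
    (K : ℕ) (hK : 0 < K) :
    ‖Complex.exp (-(I * x * t)) -
        ((besselJ 0 (-t) : ℂ) +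
          2 * ∑ k ∈ Finset.Icc 1 K,
            I ^ k * (besselJ k (-t) : ℂ) *
              (((Polynomial.Chebyshev.T ℝ (k : ℤ)).eval x : ℝ) : ℂ))‖ ≤
      2 * ∑' k : ℕ, (|t| / 2) ^ (K + 1 + k) / (Nat.factorial (K + 1 + k)) := by
  have hs := Real.summable_pow_div_factorial (|t| / 2)
  have hs' : Summable fun k : ℕ => (|t| / 2) ^ (K + 1 + k) / (Nat.factorial (K + 1 + k) : ℝ) := by
    have := (summable_nat_add_iff (K + 1)).2 hs
    refine this.congr fun k => ?_
    rw [add_comm k (K + 1)]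
  change ‖Complex.exp (-(I * x * t)) - jaSum x K (-t)‖ ≤ _
  have he : Complex.exp (-(I * x * t)) = cexp (I * x * ((-t : ℝ) : ℂ)) := by
    push_cast; congr 1; ring
  rw [he]
  have h0 := FloorSemiring.tendsto_pow_div_factorial_atTop (|t| / 2)
  have h1 := (tendsto_add_atTop_iff_nat 1).2 h0
  have h2 : Tendsto (fun N : ℕ => ((|t| / 2) ^ (N + 1) / (Nat.factorial (N + 1) : ℝ) +
      (|t| / 2) ^ N / (Nat.factorial N : ℝ)) * |t|) atTop (𝓝 0) := by
    simpa using (h1.add h0).mul_const |t|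
  have h3 := (h2.comp (tendsto_add_atTop_nat K)).add_const
    (2 * ∑' k : ℕ, (|t| / 2) ^ (K + 1 + k) / (Nat.factorial (K + 1 + k) : ℝ))
  rw [zero_add] at h3
  refine ge_of_tendsto' h3 fun m => ?_
  have a1 := jaSum_error x hx (K + m) (-t)
  have a2 := jaSum_diff x hx K m (-t)
  rw [abs_neg] at a1 a2
  have a3 := hs'.sum_le_tsum (Finset.range m) (fun k _ => by positivity)
  simp only [Function.comp, add_comm m K]
  calc _ = ‖(cexp (I * x * ((-t : ℝ) : ℂ)) - jaSum x (K + m) (-t)) +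
        (jaSum x (K + m) (-t) - jaSum x K (-t))‖ := by congr 1; ring
    _ ≤ _ := norm_add_le _ _
    _ ≤ _ := add_le_add a1 (a2.trans (by gcongr))
end
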